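/- arXiv:1606.04452 — 3 statements merged into one kernel-verified Lean document; each statement's English description precedes it below -/
import Mathlib

section
/- For all real numbers a, b, c, d with c > 0 and d > 0, the inequality (c − d)·(a²/c − b²/d) ≤ (a − b)² holds. -/
/-- Elementary pointwise Picone-type inequality: for all real `a b c d` with
`c > 0` and `d > 0`, `(c - d) * (a^2/c - b^2/d) ≤ (a - b)^2`. -/
theorem picone_pointwise_ineq (a b c d : ℝ) (hc : 0 < c) (hd : 0 < d) :
    (c - d) * (a ^ 2 / c - b ^ 2 / d) ≤ (a - b) ^ 2 := by
  have key : (a - b) ^ 2 - (c - d) * (a ^ 2 / c - b ^ 2 / d) =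
      (a * d - b * c) ^ 2 / (c * d) := by
    field_simp
    ring
  have : 0 ≤ (a * d - b * c) ^ 2 / (c * d) := by positivity
  linarith
end

section
/- Let n ≥ 1 be an integer and 0 < s < 1. Let u, v : ℝⁿ → ℝ be measurable functions with v(x) > 0 for every x ∈ ℝⁿ. Assume that the function (x,y) ↦ (v(x) − v(y))·(u(x)²/v(x) − u(y)²/v(y))/|x−y|^{n+2s} is integrable on ℝⁿ × ℝⁿ. Then ∫_{ℝⁿ}∫_{ℝⁿ} (v(x) − v(y))·(u(x)²/v(x) − u(y)²/v(y))/|x−y|^{n+2s} dx dy ≤ ∫_{ℝⁿ}∫_{ℝⁿ} (u(x) − u(y))²/|x−y|^{n+2s} dx dy, where the right-hand side is interpreted as an integral of a nonnegative function (possibly +∞). -/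
open MeasureTheory

/-- The pointwise (two-point) Picone inequality. -/
theorem sub_mul_sq_div_sub_sq_div_le_sq_sub (a b : ℝ) {c d : ℝ} (hc : 0 < c) (hd : 0 < d) :
    (c - d) * (a ^ 2 / c - b ^ 2 / d) ≤ (a - b) ^ 2 := by
  have key : (a - b) ^ 2 - (c - d) * (a ^ 2 / c - b ^ 2 / d)
      = (d * a - c * b) ^ 2 / (c * d) := by
    field_simp
    ring
  have : 0 ≤ (d * a - c * b) ^ 2 / (c * d) := by positivity
  linarith

theorem ofReal_integral_le_lintegral_ofReal {α : Type*} [MeasurableSpace α] {μ : Measure α}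
    {f : α → ℝ} (hf : Integrable f μ) :
    ENNReal.ofReal (∫ x, f x ∂μ) ≤ ∫⁻ x, ENNReal.ofReal (f x) ∂μ := by
  rw [integral_eq_lintegral_pos_part_sub_lintegral_neg_part hf]
  exact (ENNReal.ofReal_le_ofReal (sub_le_self _ ENNReal.toReal_nonneg)).trans
    ENNReal.ofReal_toReal_le

/-- **Fractional Picone inequality** (Lemma 3.4). Let `n ≥ 1`, `0 < s < 1`, and let
`u v : ℝⁿ → ℝ` be measurable with `v > 0` everywhere. If the Picone integrand
`(v(x)-v(y))(u(x)²/v(x) - u(y)²/v(y))/|x-y|^{n+2s}` is integrable on `ℝⁿ × ℝⁿ`, then its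
integral is at most the (possibly infinite) Gagliardo energy
`∫∫ (u(x)-u(y))²/|x-y|^{n+2s}`. -/
theorem fractional_picone_inequality (n : ℕ) (hn : 1 ≤ n) (s : ℝ) (hs0 : 0 < s) (hs1 : s < 1)
    (u v : EuclideanSpace ℝ (Fin n) → ℝ) (hu : Measurable u) (hv : Measurable v)
    (hvpos : ∀ x, 0 < v x)
    (hint : Integrable (fun p : EuclideanSpace ℝ (Fin n) × EuclideanSpace ℝ (Fin n) =>
      (v p.1 - v p.2) * ((u p.1) ^ 2 / v p.1 - (u p.2) ^ 2 / v p.2)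
        / ‖p.1 - p.2‖ ^ ((n : ℝ) + 2 * s))) :
    ENNReal.ofReal (∫ p : EuclideanSpace ℝ (Fin n) × EuclideanSpace ℝ (Fin n),
        (v p.1 - v p.2) * ((u p.1) ^ 2 / v p.1 - (u p.2) ^ 2 / v p.2)
          / ‖p.1 - p.2‖ ^ ((n : ℝ) + 2 * s))
      ≤ ∫⁻ p : EuclideanSpace ℝ (Fin n) × EuclideanSpace ℝ (Fin n),
          ENNReal.ofReal ((u p.1 - u p.2) ^ 2 / ‖p.1 - p.2‖ ^ ((n : ℝ) + 2 * s)) := by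
  refine (ofReal_integral_le_lintegral_ofReal hint).trans (lintegral_mono fun p => ?_)
  refine ENNReal.ofReal_le_ofReal (div_le_div_of_nonneg_right ?_ (by positivity))
  exact sub_mul_sq_div_sub_sq_div_le_sq_sub _ _ (hvpos p.1) (hvpos p.2)
end

section
/- Let H be a real Hilbert space, let λ₁ > 0, K > 0, δ > 0 be real numbers, and let T : H → H be a map satisfying 0 ≤ ⟨T(u), u⟩ ≤ ‖u‖²/λ₁ for all u ∈ H. Let h : ℝ → ℝ be a nonnegative function with h(t) = (2δ/λ₁)(t − 2K) for all t ≥ 3K. Then for every λ with λ₁ < λ < λ₁ + δ, the functional J_λ(u) = ½‖u‖² − (λ/2)⟨T(u), u⟩ + h(½‖u‖²) is coercive: J_λ(u) → +∞ as ‖u‖ → ∞. -/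
open scoped RealInnerProductSpace

/-- Coercivity of the perturbed functional `J_λ` in the proof of Theorem 1.1: in a real
Hilbert space, if `0 ≤ ⟪T(u), u⟫ ≤ ‖u‖²/λ₁`, `h ≥ 0` with `h(t) = (2δ/λ₁)(t - 2K)` for
`t ≥ 3K`, and `λ₁ < λ < λ₁ + δ`, then
`J_λ(u) = ½‖u‖² - (λ/2)⟪T(u), u⟫ + h(½‖u‖²) → +∞` as `‖u‖ → ∞`. -/
theorem Jlambda_coercive {H : Type*} [NormedAddCommGroup H] [InnerProductSpace ℝ H]
    [CompleteSpace H] (lam1 K δ : ℝ) (hlam1 : 0 < lam1) (hK : 0 < K) (hδ : 0 < δ)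
    (T : H → H) (hT0 : ∀ u : H, 0 ≤ ⟪T u, u⟫) (hT1 : ∀ u : H, ⟪T u, u⟫ ≤ ‖u‖ ^ 2 / lam1)
    (h : ℝ → ℝ) (hh0 : ∀ t : ℝ, 0 ≤ h t) (hh : ∀ t : ℝ, 3 * K ≤ t → h t = (2 * δ / lam1) * (t - 2 * K))
    (lam : ℝ) (hl1 : lam1 < lam) (hl2 : lam < lam1 + δ) :
    ∀ M : ℝ, ∃ R : ℝ, ∀ u : H, R ≤ ‖u‖ →
      M ≤ (1 / 2) * ‖u‖ ^ 2 - (lam / 2) * ⟪T u, u⟫ + h ((1 / 2) * ‖u‖ ^ 2) := by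
  intro M
  set c : ℝ := δ / lam1 with hc
  have hc0 : 0 < c := div_pos hδ hlam1
  have hMc : 0 ≤ |M| / c := by positivity
  refine ⟨1 + 2 * (|M| / c + 4 * K), fun u hu => ?_⟩
  have hsq : 2 * (|M| / c + 4 * K) ≤ ‖u‖ ^ 2 := by nlinarith
  rw [hh _ (by linarith)]
  have hratio : lam / lam1 ≤ 1 + c := by
    rw [hc, div_le_iff₀ hlam1, add_mul, div_mul_cancel₀ _ hlam1.ne']
    linarith
  have hinner : lam * ⟪T u, u⟫ ≤ (1 + c) * ‖u‖ ^ 2 :=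
    calc lam * ⟪T u, u⟫ ≤ lam * (‖u‖ ^ 2 / lam1) :=
          mul_le_mul_of_nonneg_left (hT1 u) (hlam1.trans hl1).le
      _ = lam / lam1 * ‖u‖ ^ 2 := by ring
      _ ≤ (1 + c) * ‖u‖ ^ 2 := mul_le_mul_of_nonneg_right hratio (sq_nonneg _)
  have hM : M ≤ c * ((1 / 2) * ‖u‖ ^ 2 - 4 * K) :=
    calc M ≤ |M| := le_abs_self M
      _ = c * (|M| / c) := by field_simp
      _ ≤ c * ((1 / 2) * ‖u‖ ^ 2 - 4 * K) :=
          mul_le_mul_of_nonneg_left (by linarith) hc0.le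
  have hcoef : 2 * δ / lam1 = 2 * c := by rw [hc]; ring
  rw [hcoef]
  linarith
end
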